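/- For every continuous linear operator A : H →L[ℝ] H, every integer n ≥ 1 and every x ∈ H, the commutator identity (DΠ^n)(x)(A x) − A(Π^n(x)) = n^{−2γ} · ⟨x, A x⟩ · f′(½‖x‖² n^{−2γ}) · x holds. In particular, if sup_{t ∈ [0,∞)} |f′(t)| < ∞ then ‖(DΠ^n)(x)(A x) − A(Π^n(x))‖ ≤ n^{−2γ} · (sup_{t ∈ [0,∞)} |f′(t)|) · |⟨x, A x⟩| · ‖x‖. -/

import Mathlib

open scoped RealInnerProductSpace

/-- The taming map `Π^n(x) = f(½‖x‖² n^{-2γ}) • x`. -/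
noncomputable def tamingMap {H : Type*} [NormedAddCommGroup H] [InnerProductSpace ℝ H]
    (f : ℝ → ℝ) (γ : ℝ) (n : ℕ) (x : H) : H :=
  f (2⁻¹ * ‖x‖ ^ 2 * (n : ℝ) ^ (-(2 * γ))) • x

/-- The Fréchet derivative of the taming map, applied to a vector. -/
theorem fderiv_tamingMap_apply {H : Type*} [NormedAddCommGroup H] [InnerProductSpace ℝ H]
    {f : ℝ → ℝ} (γ : ℝ) (n : ℕ) (x v : H)
    (hf : DifferentiableAt ℝ f (2⁻¹ * ‖x‖ ^ 2 * (n : ℝ) ^ (-(2 * γ)))) :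
    fderiv ℝ (tamingMap f γ n) x v =
      f (2⁻¹ * ‖x‖ ^ 2 * (n : ℝ) ^ (-(2 * γ))) • v +
        ((n : ℝ) ^ (-(2 * γ)) * ⟪x, v⟫ *
          deriv f (2⁻¹ * ‖x‖ ^ 2 * (n : ℝ) ^ (-(2 * γ)))) • x := by
  have hu := ((hasStrictFDerivAt_norm_sq x).hasFDerivAt.const_mul (2⁻¹ : ℝ)).mul_const
    ((n : ℝ) ^ (-(2 * γ)))
  have h : HasFDerivAt (tamingMap f γ n) _ x :=
    (hf.hasDerivAt.comp_hasFDerivAt x hu).smul (hasFDerivAt_id x)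
  rw [h.fderiv]
  simp only [Function.comp_apply, add_apply,
    smul_apply, ContinuousLinearMap.smulRight_apply,
    ContinuousLinearMap.id_apply, innerSL_apply_apply, smul_eq_mul, nsmul_eq_mul, Nat.cast_ofNat]
  congr 2
  ring

/-- The commutator identity
`(DΠ^n)(x)(Ax) - A(Π^n(x)) = n^{-2γ} ⟨x, Ax⟩ f'(½‖x‖² n^{-2γ}) x`, and the resulting bound
when `sup_{t ≥ 0} |f'(t)| < ∞`. -/
theorem tamingMap_commutator
    {H : Type*} [NormedAddCommGroup H] [InnerProductSpace ℝ H] [CompleteSpace H]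
    (f : ℝ → ℝ) (hf : ContDiff ℝ 2 f) (γ : ℝ) (hγ : 0 ≤ γ)
    (A : H →L[ℝ] H) (n : ℕ) (hn : 1 ≤ n) (x : H) :
    fderiv ℝ (tamingMap (H := H) f γ n) x (A x) - A (tamingMap (H := H) f γ n x)
        = ((n : ℝ) ^ (-(2 * γ)) * ⟪x, A x⟫ *
            deriv f (2⁻¹ * ‖x‖ ^ 2 * (n : ℝ) ^ (-(2 * γ)))) • x ∧
      (BddAbove ((fun t => |deriv f t|) '' Set.Ici (0 : ℝ)) →
        ‖fderiv ℝ (tamingMap (H := H) f γ n) x (A x) - A (tamingMap (H := H) f γ n x)‖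
          ≤ (n : ℝ) ^ (-(2 * γ)) * sSup ((fun t => |deriv f t|) '' Set.Ici (0 : ℝ)) *
              |⟪x, A x⟫| * ‖x‖) := by
  have h : fderiv ℝ (tamingMap (H := H) f γ n) x (A x) - A (tamingMap (H := H) f γ n x)
      = ((n : ℝ) ^ (-(2 * γ)) * ⟪x, A x⟫ *
          deriv f (2⁻¹ * ‖x‖ ^ 2 * (n : ℝ) ^ (-(2 * γ)))) • x := by
    rw [fderiv_tamingMap_apply γ n x (A x) (hf.differentiable (by norm_num) _), tamingMap,
      map_smul, add_sub_cancel_left]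
  refine ⟨h, fun hb => ?_⟩
  have hsup := le_csSup hb (Set.mem_image_of_mem (fun t => |deriv f t|)
    (show 2⁻¹ * ‖x‖ ^ 2 * (n : ℝ) ^ (-(2 * γ)) ∈ Set.Ici (0 : ℝ) from
      Set.mem_Ici.2 (by positivity)))
  rw [h, norm_smul, norm_mul, norm_mul,
    Real.norm_of_nonneg (by positivity : 0 ≤ (n : ℝ) ^ (-(2 * γ))),
    Real.norm_eq_abs, Real.norm_eq_abs, mul_right_comm ((n : ℝ) ^ (-(2 * γ)))]
  gcongr
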